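/- Let π = (P_1,…,P_p) ∈ OP_n, let σ ∈ OP_n with σ ≤ π, and let N_1,…,N_p be natural numbers. Then the number of tuples (i_1,…,i_n) with i_k ∈ [N_{π(k)}] for every k ∈ [n] and π ⋏ κ(i_1,…,i_n) = σ equals ∏_{j=1}^p C(N_j, #(σ⌋_{P_j})), where C(N,k) is the binomial coefficient (equal to 0 when N < k). -/

import Mathlib

open Finset

namespace OSPpaper

/-- A *block* is a subset of `[n] = Fin n`. -/
abbrev Block (n : ℕ) := Finset (Fin n)

/-- `l` is an ordered set partition of the ground set `E ⊆ [n]`: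
a finite sequence of pairwise disjoint nonempty subsets of `E` whose union is `E`. -/
def IsOSP {n : ℕ} (E : Finset (Fin n)) (l : List (Block n)) : Prop :=
  (∀ P ∈ l, P.Nonempty) ∧ l.Pairwise (fun P Q => Disjoint P Q) ∧
    (∀ P ∈ l, P ⊆ E) ∧ ∀ i ∈ E, ∃ P ∈ l, i ∈ P

/-- Union of a list of blocks. -/
def unionList {n : ℕ} (l : List (Block n)) : Block n := l.foldr (· ∪ ·) ∅

/-- The order on ordered set partitions: `π ≤ σ` iff every block of `σ` is the union
of a contiguous run of blocks of `π` (runs taken in order). -/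
def OSPle {n : ℕ} (π σ : List (Block n)) : Prop :=
  ∃ L : List (List (Block n)), L.flatten = π ∧ σ = L.map unionList

/-- The restriction `σ⌋_P`: intersect every block with `P` and delete the empty intersections. -/
def restrict {n : ℕ} (σ : List (Block n)) (P : Block n) : List (Block n) :=
  (σ.map (fun Q => Q ∩ P)).filter (fun Q => decide (Q ≠ ∅))

/-- The quasi-meet `π ⋏ σ`: the concatenation `σ⌋_{P₁} σ⌋_{P₂} ⋯ σ⌋_{P_p}`. -/
def qmeet {n : ℕ} (π σ : List (Block n)) : List (Block n) :=
  (π.map (fun P => restrict σ P)).flatten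

/-- Refinement: every block of `σ` is contained in some block of `τ`.
(As a relation on the underlying unordered partitions, this is the refinement order;
in particular `refines τ η` says `τ̄ ≤ η̄`.) -/
def refines {n : ℕ} (σ τ : List (Block n)) : Prop := ∀ P ∈ σ, ∃ Q ∈ τ, P ⊆ Q

/-- An interval partition of `[m]`, with its blocks listed in (the unique) increasing order:
an ordered set partition whose consecutive blocks are completely ordered. -/
def IsIP {m : ℕ} (l : List (Finset (Fin m))) : Prop :=
  IsOSP Finset.univ l ∧ l.Chain' (fun P Q => ∀ a ∈ P, ∀ b ∈ Q, a < b)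

/-- The (0-based) index `π(k)` of the block of `π` containing `k`. -/
def blockIdx {n : ℕ} (π : List (Block n)) (k : Fin n) : ℕ :=
  π.findIdx (fun P => decide (k ∈ P))

/-- The ordered kernel `κ(i₁,…,iₙ)` of a tuple: the nonempty level sets of the tuple,
listed in increasing order of the value. -/
def kernel {n : ℕ} (i : Fin n → ℕ) : List (Block n) :=
  ((Finset.image i Finset.univ).sort (· ≤ ·)).map
    (fun v => Finset.univ.filter (fun k => i k = v))

/-- `[σ:π] = ∏_{P ∈ π} #(σ⌋_P)`. -/
def colonNum {n : ℕ} (σ π : List (Block n)) : ℕ :=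
  (π.map (fun P => (restrict σ P).length)).prod

/-- `[σ:π]! = ∏_{P ∈ π} #(σ⌋_P)!`. -/
def colonFac {n : ℕ} (σ π : List (Block n)) : ℕ :=
  (π.map (fun P => Nat.factorial (restrict σ P).length)).prod

/-- For `τ̄ ≤ η̄` the sequence `(m_1,…,m_s)`: `m_i` is the (0-based) index of the block of `η`
containing the `i`-th block of `τ`. -/
def mseq {n : ℕ} (τ η : List (Block n)) : List ℕ :=
  τ.map (fun T => η.findIdx (fun E => decide (T ⊆ E)))

/-- number of ascents of a sequence -/
def ascL (l : List ℕ) : ℕ := ((l.zip l.tail).filter (fun p => decide (p.1 < p.2))).length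
/-- number of descents of a sequence -/
def desL (l : List ℕ) : ℕ := ((l.zip l.tail).filter (fun p => decide (p.2 < p.1))).length
/-- number of plateaux of a sequence -/
def platL (l : List ℕ) : ℕ := ((l.zip l.tail).filter (fun p => decide (p.1 = p.2))).length

/-- `asc_η(τ)` -/
def ascN {n : ℕ} (τ η : List (Block n)) : ℕ := ascL (mseq τ η)
/-- `des_η(τ)` -/
def desN {n : ℕ} (τ η : List (Block n)) : ℕ := desL (mseq τ η)
/-- `plat_η(τ)` -/
def platN {n : ℕ} (τ η : List (Block n)) : ℕ := platL (mseq τ η)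

/-- lengths of the maximal ascending runs of a sequence -/
def ascRunLengths (l : List ℕ) : List ℕ :=
  (l.splitBy (fun a b => decide (a < b))).map List.length
/-- lengths of the maximal level (constant) runs of a sequence -/
def levelRunLengths (l : List ℕ) : List ℕ :=
  (l.splitBy (fun a b => decide (a = b))).map List.length

/-- `μ̃(σ,π) = (−1)^{|σ|−|π|} / [σ:π]` (real-valued). -/
noncomputable def muR {n : ℕ} (σ π : List (Block n)) : ℝ :=
  (-1 : ℝ) ^ (σ.length - π.length) / (colonNum σ π : ℝ)

/-- `ζ̃(σ,π) = 1 / [σ:π]!` (real-valued). -/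
noncomputable def zetaR {n : ℕ} (σ π : List (Block n)) : ℝ :=
  1 / (colonFac σ π : ℝ)

/-- The Weisner coefficient `w(τ,η) = ∑_{σ ⋏ η = τ} μ̃(σ, 1̂ₙ)`. -/
noncomputable def wcoef {n : ℕ} (τ η : List (Block n)) : ℝ :=
  ∑ᶠ σ ∈ {σ : List (Block n) | IsOSP Finset.univ σ ∧ qmeet σ η = τ},
    muR σ [(Finset.univ : Block n)]

/-- The Goldberg coefficient `g(τ,η) = ∑_{σ ≥ τ} ζ̃(τ,σ) w(σ,η)`. -/
noncomputable def gcoef {n : ℕ} (τ η : List (Block n)) : ℝ :=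
  ∑ᶠ σ ∈ {σ : List (Block n) | IsOSP Finset.univ σ ∧ OSPle τ σ}, zetaR τ σ * wcoef σ η

theorem restrict_append {n : ℕ} (l m : List (Block n)) (P : Block n) :
    restrict (l ++ m) P = restrict l P ++ restrict m P := by
  simp [restrict]

theorem restrict_eq_nil {n : ℕ} {l : List (Block n)} {P : Block n}
    (h : ∀ Q ∈ l, Disjoint Q P) : restrict l P = [] := by
  simp only [restrict, List.filter_eq_nil_iff, List.mem_map]
  rintro _ ⟨Q, hQ, rfl⟩
  simpa using Finset.disjoint_iff_inter_eq_empty.mp (h Q hQ)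

theorem restrict_eq_self {n : ℕ} {l : List (Block n)} {P : Block n}
    (hne : ∀ Q ∈ l, Q.Nonempty) (h : ∀ Q ∈ l, Q ⊆ P) : restrict l P = l := by
  have hmap : l.map (fun Q => Q ∩ P) = l := by
    conv_rhs => rw [← List.map_id l]
    exact List.map_congr_left fun Q hQ => Finset.inter_eq_left.mpr (h Q hQ)
  rw [restrict, hmap, List.filter_eq_self]
  intro Q hQ
  simpa using (hne Q hQ).ne_empty

theorem mem_restrict {n : ℕ} {l : List (Block n)} {P R : Block n} :
    R ∈ restrict l P ↔ R.Nonempty ∧ ∃ Q ∈ l, Q ∩ P = R := by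
  simp [restrict, Finset.nonempty_iff_ne_empty, and_comm]

theorem isOSP_restrict {n : ℕ} {l : List (Block n)} {E P : Block n} (hl : IsOSP E l)
    (hP : P ⊆ E) : IsOSP P (restrict l P) := by
  refine ⟨fun R hR => (mem_restrict.mp hR).1, ?_, ?_, ?_⟩
  · refine List.Pairwise.filter _ (List.Pairwise.map _ ?_ hl.2.1)
    exact fun Q R h => h.mono Finset.inter_subset_left Finset.inter_subset_left
  · intro R hR
    obtain ⟨-, Q, -, rfl⟩ := mem_restrict.mp hR
    exact Finset.inter_subset_right
  · intro k hk
    obtain ⟨Q, hQ, hkQ⟩ := hl.2.2.2 k (hP hk)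
    have hk' : k ∈ Q ∩ P := Finset.mem_inter.mpr ⟨hkQ, hk⟩
    exact ⟨Q ∩ P, mem_restrict.mpr ⟨⟨k, hk'⟩, Q, hQ, rfl⟩, hk'⟩

theorem mem_unionList {n : ℕ} {l : List (Block n)} {k : Fin n} :
    k ∈ unionList l ↔ ∃ P ∈ l, k ∈ P := by
  induction l with
  | nil => simp [unionList]
  | cons P l ih =>
    have : unionList (P :: l) = P ∪ unionList l := rfl
    simp [this, ih]

theorem subset_unionList {n : ℕ} {l : List (Block n)} {P : Block n} (hP : P ∈ l) :
    P ⊆ unionList l := fun _ hk => mem_unionList.mpr ⟨P, hP, hk⟩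

/-- If `σ ≤ π` then `π ⋏ σ = σ`. -/
theorem qmeet_eq_self_of_le {n : ℕ} {π σ : List (Block n)} (hne : ∀ P ∈ σ, P.Nonempty)
    (hdis : σ.Pairwise (fun P Q => Disjoint P Q)) (h : OSPle σ π) : qmeet π σ = σ := by
  obtain ⟨L, rfl, rfl⟩ := h
  induction L with
  | nil => simp [qmeet]
  | cons l L ih =>
    rw [List.flatten_cons, List.pairwise_append] at hdis
    obtain ⟨-, hL, hlL⟩ := hdis
    rw [List.flatten_cons] at hne
    have ih := ih (fun P hP => hne P (List.mem_append_right _ hP)) hL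
    have hhead : restrict (l ++ L.flatten) (unionList l) = l := by
      rw [restrict_append, restrict_eq_self (fun Q hQ => hne Q (List.mem_append_left _ hQ))
        (fun Q hQ => subset_unionList hQ), restrict_eq_nil, List.append_nil]
      intro Q hQ
      rw [Finset.disjoint_left]
      intro k hk hk'
      obtain ⟨P, hP, hkP⟩ := mem_unionList.mp hk'
      exact Finset.disjoint_left.mp (hlL P hP Q hQ) hkP hk
    have htail : ∀ m ∈ L, restrict (l ++ L.flatten) (unionList m)
        = restrict L.flatten (unionList m) := by
      intro m hm
      rw [restrict_append, restrict_eq_nil, List.nil_append]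
      intro Q hQ
      rw [Finset.disjoint_left]
      intro k hk hk'
      obtain ⟨P, hP, hkP⟩ := mem_unionList.mp hk'
      exact Finset.disjoint_left.mp
        (hlL Q hQ P (List.mem_flatten.mpr ⟨m, hm, hP⟩)) hk hkP
    simp only [qmeet, List.map_map, List.map_cons, List.flatten_cons] at ih ⊢
    rw [hhead, List.map_congr_left (f := (fun P => restrict (l ++ L.flatten) P) ∘ unionList)
      (g := (fun P => restrict L.flatten P) ∘ unionList) htail, ih]

theorem restrict_qmeet {n : ℕ} {π : List (Block n)} (κ : List (Block n))
    (hdis : π.Pairwise (fun P Q => Disjoint P Q)) {P : Block n} (hP : P ∈ π) :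
    restrict (qmeet π κ) P = restrict κ P := by
  have hsub : ∀ {Q R : Block n}, R ∈ restrict κ Q → R ⊆ Q := by
    intro Q R hR
    obtain ⟨-, S, -, rfl⟩ := mem_restrict.mp hR
    exact Finset.inter_subset_right
  induction π with
  | nil => simp at hP
  | cons Q π ih =>
    rw [List.pairwise_cons] at hdis
    have hq : qmeet (Q :: π) κ = restrict κ Q ++ qmeet π κ := by simp [qmeet]
    rw [hq, restrict_append]
    rcases List.mem_cons.mp hP with rfl | hP
    · rw [restrict_eq_self (fun R hR => (mem_restrict.mp hR).1) (fun R hR => hsub hR),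
        restrict_eq_nil (l := qmeet π κ), List.append_nil]
      intro R hR
      simp only [qmeet, List.mem_flatten, List.mem_map] at hR
      obtain ⟨_, ⟨S, hS, rfl⟩, hR⟩ := hR
      exact ((hdis.1 S hS).mono_right (hsub hR)).symm
    · rw [ih hdis.2 hP, restrict_eq_nil, List.nil_append]
      exact fun R hR => (hdis.1 P hP).mono_left (hsub hR)

theorem qmeet_eq_iff {n : ℕ} {π σ : List (Block n)} (κ : List (Block n))
    (hπ : IsOSP Finset.univ π) (hσ : IsOSP Finset.univ σ) (h : OSPle σ π) :
    qmeet π κ = σ ↔ ∀ P ∈ π, restrict κ P = restrict σ P := by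
  constructor
  · rintro rfl P hP
    rw [restrict_qmeet κ hπ.2.1 hP]
  · intro hκ
    conv_rhs => rw [← qmeet_eq_self_of_le hσ.1 hσ.2.1 h]
    rw [qmeet, qmeet, List.map_congr_left hκ]

/-- The restriction of an ordered kernel to `P` lists the level sets on `P` by increasing value. -/
theorem restrict_kernel {n : ℕ} (i : Fin n → ℕ) (P : Block n) :
    restrict (kernel i) P = ((P.image i).sort (· ≤ ·)).map (fun v => {k ∈ P | i k = v}) := by
  have hsort : ((Finset.univ.image i).sort (· ≤ ·)).filter
      (fun v => decide (Finset.univ.filter (fun k => i k = v) ∩ P ≠ ∅)) = (P.image i).sort (· ≤ ·) := by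
    refine List.SortedLT.eq_of_mem_iff ?_ (Finset.sortedLT_sort _) ?_
    · exact ((Finset.sortedLT_sort _).pairwise.filter _).sortedLT
    · intro v
      simp only [List.mem_filter, Finset.mem_sort, Finset.mem_image, Finset.mem_univ, true_and,
        decide_eq_true_eq, ← Finset.nonempty_iff_ne_empty, Finset.Nonempty, Finset.mem_inter,
        Finset.mem_filter]
      grind
  rw [← hsort, restrict, kernel, List.map_map, List.filter_map]
  refine List.map_congr_left fun v _ => ?_
  ext k
  simp [and_comm]

theorem blockIdx_eq {n : ℕ} {l : List (Block n)} (hdis : l.Pairwise (fun P Q => Disjoint P Q))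
    {m : ℕ} (hm : m < l.length) {k : Fin n} (hk : k ∈ l[m]) : blockIdx l k = m := by
  rw [blockIdx, List.findIdx_eq hm]
  refine ⟨by simpa using hk, fun j hj => ?_⟩
  have := Finset.disjoint_right.mp (List.pairwise_iff_getElem.mp hdis j m (by omega) hm hj) hk
  simpa using this

theorem blockIdx_lt {n : ℕ} {l : List (Block n)} {k : Fin n} (h : ∃ P ∈ l, k ∈ P) :
    blockIdx l k < l.length := by
  simpa [blockIdx, List.findIdx_lt_length] using h

theorem mem_getElem_blockIdx {n : ℕ} {l : List (Block n)} {k : Fin n}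
    (h : blockIdx l k < l.length) : k ∈ l[blockIdx l k] := by
  exact of_decide_eq_true (List.findIdx_getElem (p := fun P => decide (k ∈ P)) (w := h))

/-- A tuple is determined on `P` by its set of values on `P` and its ordered level sets on `P`. -/
theorem eqOn_of_restrict_kernel_eq {n : ℕ} {i i' : Fin n → ℕ} {P : Block n}
    (himg : P.image i = P.image i') (h : restrict (kernel i) P = restrict (kernel i') P)
    {k : Fin n} (hk : k ∈ P) : i k = i' k := by
  rw [restrict_kernel, restrict_kernel, ← himg, List.map_inj_left] at h
  have := h (i k) (by simpa using ⟨k, hk, rfl⟩)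
  have hk' : k ∈ ({k' ∈ P | i' k' = i k} : Block n) := by rw [← this]; simpa using hk
  exact (Finset.mem_filter.mp hk').2.symm

/-- Numbering the blocks of `l` increasingly by the elements of `S` gives a tuple whose values
on `P` are `S` and whose ordered level sets on `P` are `l`. -/
theorem restrict_kernel_of_sort {n : ℕ} {P : Block n} {l : List (Block n)} (hl : IsOSP P l)
    {S : Finset ℕ} (hS : S.card = l.length) {i : Fin n → ℕ}
    (hi : ∀ k ∈ P, i k = (S.sort (· ≤ ·)).getD (blockIdx l k) 0) :
    P.image i = S ∧ restrict (kernel i) P = l := by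
  have hlen : (S.sort (· ≤ ·)).length = l.length := by rw [Finset.length_sort, hS]
  have hlt : ∀ k ∈ P, blockIdx l k < l.length := fun k hk => blockIdx_lt (hl.2.2.2 k hk)
  have hval : ∀ k (hk : k ∈ P), i k = (S.sort (· ≤ ·))[blockIdx l k]'(hlen ▸ hlt k hk) := by
    intro k hk
    rw [hi k hk, List.getD_eq_getElem]
  have himg : P.image i = S := by
    ext v
    rw [Finset.mem_image]
    constructor
    · rintro ⟨k, hk, rfl⟩
      rw [hval k hk, ← Finset.mem_sort (· ≤ ·)]
      exact List.getElem_mem _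
    · intro hv
      obtain ⟨m, hm, rfl⟩ := List.mem_iff_getElem.mp ((Finset.mem_sort (· ≤ ·)).mpr hv)
      have hml : m < l.length := hlen ▸ hm
      obtain ⟨k, hk⟩ := hl.1 _ (List.getElem_mem hml)
      have hkP := hl.2.2.1 _ (List.getElem_mem hml) hk
      refine ⟨k, hkP, ?_⟩
      simp only [hval k hkP, blockIdx_eq hl.2.1 hml hk]
  refine ⟨himg, ?_⟩
  rw [restrict_kernel, himg]
  refine List.ext_getElem (by rw [List.length_map, hlen]) fun m hm hml => ?_
  ext k
  rw [List.getElem_map, Finset.mem_filter]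
  constructor
  · rintro ⟨hk, hik⟩
    rw [hval k hk, (Finset.sort_nodup S (· ≤ ·)).getElem_inj_iff] at hik
    subst hik
    exact mem_getElem_blockIdx hml
  · intro hk
    have hkP := hl.2.2.1 _ (List.getElem_mem hml) hk
    refine ⟨hkP, ?_⟩
    simp only [hval k hkP, blockIdx_eq hl.2.1 hml hk]

/-- Let `π = (P₁,…,P_p) ∈ OP_n`, `σ ∈ OP_n` with `σ ≤ π`, and natural numbers
`N₁,…,N_p` (given here as `N : ℕ → ℕ`, `N j` being the number attached to the `(j+1)`-st block).
The number of tuples `(i₁,…,iₙ)` with `i_k ∈ [N_{π(k)}] = {1,…,N_{π(k)}}` for every `k` and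
`π ⋏ κ(i₁,…,iₙ) = σ` equals `∏_{j=1}^p C(N_j, #(σ⌋_{P_j}))`. -/
theorem statement8 {n : ℕ} (π σ : List (Block n))
    (hπ : IsOSP Finset.univ π) (hσ : IsOSP Finset.univ σ) (h : OSPle σ π) (N : ℕ → ℕ) :
    Set.ncard {i : Fin n → ℕ |
        (∀ k : Fin n, i k ∈ Finset.Icc 1 (N (blockIdx π k))) ∧ qmeet π (kernel i) = σ}
      = ∏ j ∈ Finset.range π.length, Nat.choose (N j) ((restrict σ (π.getD j ∅)).length) := by
  have hsub : ∀ P : Block n, IsOSP P (restrict σ P) := fun P =>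
    isOSP_restrict hσ (Finset.subset_univ P)
  have hlt : ∀ k, blockIdx π k < π.length := fun k =>
    blockIdx_lt (hπ.2.2.2 k (Finset.mem_univ k))
  let T : Finset (Fin π.length → Finset ℕ) := Fintype.piFinset fun j =>
    Finset.powersetCard (restrict σ π[j]).length (Finset.Icc 1 (N j))
  have hT : T.card = ∏ j ∈ Finset.range π.length,
      Nat.choose (N j) ((restrict σ (π.getD j ∅)).length) := by
    rw [Finset.prod_range, Fintype.card_piFinset]
    refine Finset.prod_congr rfl fun j _ => ?_
    rw [Finset.card_powersetCard, Nat.card_Icc, Nat.add_sub_cancel,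
      List.getD_eq_getElem _ _ j.isLt, Fin.getElem_fin]
  rw [← hT, ← Set.ncard_coe_finset]
  refine Set.BijOn.ncard_eq (f := fun i j => π[j].image i) ⟨?_, ?_, ?_⟩
  · rintro i ⟨hi, hmeet⟩
    rw [qmeet_eq_iff _ hπ hσ h] at hmeet
    simp only [T, Finset.mem_coe, Fintype.mem_piFinset, Finset.mem_powersetCard]
    intro j
    constructor
    · intro v hv
      obtain ⟨k, hk, rfl⟩ := Finset.mem_image.mp hv
      simpa only [blockIdx_eq hπ.2.1 j.isLt hk] using hi k
    · rw [Fin.getElem_fin, ← hmeet _ (List.getElem_mem j.isLt), restrict_kernel,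
        List.length_map, Finset.length_sort]
  · rintro i ⟨-, hmeet⟩ i' ⟨-, hmeet'⟩ heq
    rw [qmeet_eq_iff _ hπ hσ h] at hmeet hmeet'
    funext k
    have hP := List.getElem_mem (hlt k)
    exact eqOn_of_restrict_kernel_eq (congrFun heq ⟨blockIdx π k, hlt k⟩)
      ((hmeet _ hP).trans (hmeet' _ hP).symm) (mem_getElem_blockIdx (hlt k))
  · intro f hf
    simp only [T, Finset.mem_coe, Fintype.mem_piFinset, Finset.mem_powersetCard] at hf
    let i : Fin n → ℕ := fun k => ((f ⟨blockIdx π k, hlt k⟩).sort (· ≤ ·)).getD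
      (blockIdx (restrict σ (π[blockIdx π k]'(hlt k))) k) 0
    have key : ∀ j : Fin π.length,
        π[j].image i = f j ∧ restrict (kernel i) π[j] = restrict σ π[j] := by
      intro j
      refine restrict_kernel_of_sort (hsub _) (hf j).2 fun k hk => ?_
      have hj : (⟨blockIdx π k, hlt k⟩ : Fin π.length) = j :=
        Fin.ext (blockIdx_eq hπ.2.1 j.isLt hk)
      subst hj
      rfl
    refine ⟨i, ⟨fun k => ?_, ?_⟩, funext fun j => (key j).1⟩
    · have hk := Finset.mem_image_of_mem i (mem_getElem_blockIdx (hlt k))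
      have hkey := (key ⟨blockIdx π k, hlt k⟩).1
      exact (hf ⟨blockIdx π k, hlt k⟩).1 (hkey ▸ hk)
    · rw [qmeet_eq_iff _ hπ hσ h]
      intro P hP
      obtain ⟨j, hj, rfl⟩ := List.mem_iff_getElem.mp hP
      exact (key ⟨j, hj⟩).2

end OSPpaper
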